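/- Let h : ℝ² → ℝ be a positively homogeneous function and let E* be a finite upper exhauster of h that is minimal by inclusion (no proper subfamily of E* is an upper exhauster of h). Then for every C ∈ E* there exists a closed nondegenerate interval I_C = [α_C, β_C] ⊆ [0, 2π] (with α_C < β_C) such that ρ_C(θ) = ρ(θ) for all θ ∈ I_C, where ρ(θ) = min_{D ∈ E*} ρ_D(θ). -/

import Mathlib

open Set Real
open scoped RealInnerProductSpace

noncomputable def suppFn (C : Set (EuclideanSpace ℝ (Fin 2))) (g : EuclideanSpace ℝ (Fin 2)) : ℝ :=
  sSup ((fun v => ⟪v, g⟫) '' C)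

def IsUpperExhauster (h : EuclideanSpace ℝ (Fin 2) → ℝ)
    (E : Set (Set (EuclideanSpace ℝ (Fin 2)))) : Prop :=
  (∀ C ∈ E, C.Nonempty ∧ IsCompact C ∧ Convex ℝ C) ∧
  ∀ g, IsGLB ((fun C => suppFn C g) '' E) (h g)

noncomputable def udir (θ : ℝ) : EuclideanSpace ℝ (Fin 2) :=
  (EuclideanSpace.equiv (Fin 2) ℝ).symm ![Real.cos θ, Real.sin θ]

noncomputable def rho (C : Set (EuclideanSpace ℝ (Fin 2))) (θ : ℝ) : ℝ := suppFn C (udir θ)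

theorem continuous_suppFn {C : Set (EuclideanSpace ℝ (Fin 2))} (hC : IsCompact C) :
    Continuous (suppFn C) :=
  hC.continuous_sSup (f := fun g v => ⟪v, g⟫) (continuous_snd.inner continuous_fst)

theorem suppFn_smul (C : Set (EuclideanSpace ℝ (Fin 2))) {r : ℝ} (hr : 0 ≤ r)
    (g : EuclideanSpace ℝ (Fin 2)) : suppFn C (r • g) = r * suppFn C g := by
  unfold suppFn
  rw [← smul_eq_mul, ← Real.sSup_smul_of_nonneg hr, ← image_smul, image_image]
  simp only [real_inner_smul_right, smul_eq_mul]

theorem continuous_udir : Continuous udir := by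
  unfold udir
  refine (EuclideanSpace.equiv (Fin 2) ℝ).symm.continuous.comp (continuous_pi fun i => ?_)
  fin_cases i
  · exact continuous_cos
  · exact continuous_sin

theorem udir_periodic : Function.Periodic udir (2 * π) := fun θ => by
  simp [udir]

theorem exists_eq_smul_udir (g : EuclideanSpace ℝ (Fin 2)) :
    ∃ r : ℝ, 0 ≤ r ∧ ∃ θ ∈ Ico 0 (2 * π), g = r • udir θ := by
  obtain ⟨θ, hθ, h⟩ := udir_periodic.exists_mem_Ico₀ two_pi_pos (Complex.arg ⟨g 0, g 1⟩)
  refine ⟨‖(⟨g 0, g 1⟩ : ℂ)‖, norm_nonneg _, θ, hθ, ?_⟩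
  rw [← h]
  ext i
  fin_cases i <;> simp [udir]

/-- A set that cannot be dropped from an upper exhauster is strictly smallest somewhere. -/
theorem exists_forall_suppFn_lt {h : EuclideanSpace ℝ (Fin 2) → ℝ}
    {E : Set (Set (EuclideanSpace ℝ (Fin 2)))} (hE : IsUpperExhauster h E)
    {C : Set (EuclideanSpace ℝ (Fin 2))} (hmin : ¬ IsUpperExhauster h (E \ {C})) :
    ∃ g, ∀ D ∈ E \ {C}, suppFn C g < suppFn D g := by
  by_contra! hcon
  refine hmin ⟨fun D hD => hE.1 D hD.1, fun g => ⟨?_, fun b hb => ?_⟩⟩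
  · rintro _ ⟨D, hD, rfl⟩
    exact (hE.2 g).1 ⟨D, hD.1, rfl⟩
  · refine (hE.2 g).2 ?_
    rintro _ ⟨D, hD, rfl⟩
    by_cases hDC : D = C
    · obtain ⟨D', hD', hle⟩ := hcon g
      exact (hb ⟨D', hD', rfl⟩).trans (hDC ▸ hle)
    · exact hb ⟨D, ⟨hD, hDC⟩, rfl⟩

theorem minimal_imp_interval_of_coincidence
    (h : EuclideanSpace ℝ (Fin 2) → ℝ)
    (hph : ∀ (l : ℝ) (g : EuclideanSpace ℝ (Fin 2)), 0 ≤ l → h (l • g) = l * h g)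
    (E : Set (Set (EuclideanSpace ℝ (Fin 2)))) (hfin : E.Finite)
    (hE : IsUpperExhauster h E)
    (hmin : ¬ ∃ E' ⊂ E, IsUpperExhauster h E') :
    ∀ C ∈ E, ∃ αC βC : ℝ, 0 ≤ αC ∧ αC < βC ∧ βC ≤ 2 * π ∧
      ∀ θ ∈ Icc αC βC, rho C θ = sInf ((fun D => rho D θ) '' E) := by
  intro C hC
  obtain ⟨g, hgU⟩ := exists_forall_suppFn_lt hE fun hE' =>
    hmin ⟨E \ {C}, sdiff_singleton_ssubset.2 hC, hE'⟩
  set U : Set (EuclideanSpace ℝ (Fin 2)) := {g | ∀ D ∈ E \ {C}, suppFn C g < suppFn D g} with hU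
  have hUo : IsOpen U := by
    have : U = ⋂ D ∈ E \ {C}, {g | suppFn C g < suppFn D g} := by ext; simp [hU]
    rw [this]
    exact hfin.sdiff.isOpen_biInter fun D hD =>
      isOpen_lt (continuous_suppFn (hE.1 C hC).2.1) (continuous_suppFn (hE.1 D hD.1).2.1)
  obtain ⟨r, hr, θ, hθ, rfl⟩ := exists_eq_smul_udir g
  have hθU : udir θ ∈ U := fun D hD => by
    have := hgU D hD
    rw [suppFn_smul _ hr, suppFn_smul _ hr] at this
    exact lt_of_mul_lt_mul_left this hr
  obtain ⟨ε, hε, hball⟩ := Metric.isOpen_iff.1 (hUo.preimage continuous_udir) θ hθU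
  refine ⟨θ, min (θ + ε / 2) (2 * π), hθ.1, lt_min (by linarith) hθ.2, min_le_right _ _,
    fun t ht => ?_⟩
  have htU : udir t ∈ U := hball <| by
    have := ht.2.trans (min_le_left _ _)
    rw [Metric.mem_ball, Real.dist_eq, abs_of_nonneg (sub_nonneg.2 ht.1)]
    linarith
  have hleast : IsLeast ((fun D => rho D t) '' E) (rho C t) := by
    refine ⟨⟨C, hC, rfl⟩, ?_⟩
    rintro _ ⟨D, hD, rfl⟩
    by_cases hDC : D = C
    · rw [hDC]
    · exact (htU D ⟨hD, hDC⟩).le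
  exact hleast.csInf_eq.symm
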